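/- For every nonzero real number β and every positive integer b, setting h = 2^{-b}, the quantity θ = ((e^{βh}(βh − 1) + 1)(1 − e^{β})) / ((1 − e^{βh})(e^{β}(β − 1) + 1)) satisfies 0 < θ < 1. -/

import Mathlib

open Real

theorem exp_mul_sub_one_add_one_pos {x : ℝ} (hx : x ≠ 0) :
    0 < Real.exp x * (x - 1) + 1 := by
  have h1 : -x + 1 < Real.exp (-x) := Real.add_one_lt_exp (neg_ne_zero.mpr hx)
  have h2 : Real.exp x * Real.exp (-x) = 1 := by rw [← Real.exp_add]; simp
  nlinarith [mul_pos (Real.exp_pos x) (sub_pos.mpr h1)]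

theorem mul_exp_mul_exp_sub_one_lt {x h : ℝ} (hx : x ≠ 0) (h0 : 0 < h) (h1 : h < 1) :
    h * Real.exp (x * h) * (Real.exp x - 1) < (Real.exp (x * h) - 1) * Real.exp x := by
  have hconv := strictConvexOn_exp.2 (Set.mem_univ (-x)) (Set.mem_univ 0)
    (neg_ne_zero.mpr hx) h0 (sub_pos.mpr h1) (by ring)
  simp only [smul_eq_mul, mul_zero, add_zero, Real.exp_zero, mul_one] at hconv
  rw [show h * -x = -(x * h) by ring, Real.exp_neg, Real.exp_neg] at hconv
  have hmul := mul_lt_mul_of_pos_right hconv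
    (mul_pos (Real.exp_pos (x * h)) (Real.exp_pos x))
  have hA := (Real.exp_pos (x * h)).ne'
  have hB := (Real.exp_pos x).ne'
  have e1 : (Real.exp (x * h))⁻¹ * (Real.exp (x * h) * Real.exp x) = Real.exp x := by
    field_simp
  have e2 : (h * (Real.exp x)⁻¹ + (1 - h)) * (Real.exp (x * h) * Real.exp x) =
      h * Real.exp (x * h) + (1 - h) * (Real.exp (x * h) * Real.exp x) := by
    field_simp
  rw [e1, e2] at hmul
  linarith

/-- For every nonzero real β and positive integer b, with h = 2^{-b}, the mixture
parameter θ = ((e^{βh}(βh − 1) + 1)(1 − e^β)) / ((1 − e^{βh})(e^β(β − 1) + 1))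
lies strictly between 0 and 1. -/
theorem theta_mem_unit_interval (β : ℝ) (hβ : β ≠ 0) (b : ℕ) (hb : 0 < b) :
    0 < (Real.exp (β * (1 / 2 ^ b)) * (β * (1 / 2 ^ b) - 1) + 1) * (1 - Real.exp β) /
          ((1 - Real.exp (β * (1 / 2 ^ b))) * (Real.exp β * (β - 1) + 1)) ∧
      (Real.exp (β * (1 / 2 ^ b)) * (β * (1 / 2 ^ b) - 1) + 1) * (1 - Real.exp β) /
          ((1 - Real.exp (β * (1 / 2 ^ b))) * (Real.exp β * (β - 1) + 1)) < 1 := by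
  have h0 : (0 : ℝ) < 1 / 2 ^ b := by positivity
  have h1 : (1 : ℝ) / 2 ^ b < 1 := by
    rw [div_lt_one (by positivity)]
    exact one_lt_pow₀ one_lt_two hb.ne'
  generalize (1 : ℝ) / 2 ^ b = h at h0 h1 ⊢
  have hNA := exp_mul_sub_one_add_one_pos (mul_ne_zero hβ h0.ne')
  have hNB := exp_mul_sub_one_add_one_pos hβ
  have hkey := mul_exp_mul_exp_sub_one_lt hβ h0 h1
  rcases lt_or_gt_of_ne hβ with hneg | hpos
  · have hA : 0 < 1 - Real.exp (β * h) :=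
      sub_pos.mpr (Real.exp_lt_one_iff.mpr (mul_neg_of_neg_of_pos hneg h0))
    have hB : 0 < 1 - Real.exp β := sub_pos.mpr (Real.exp_lt_one_iff.mpr hneg)
    refine ⟨by positivity, ?_⟩
    rw [div_lt_one (by positivity)]
    linarith [mul_lt_mul_of_neg_left hkey hneg]
  · have hA : 1 - Real.exp (β * h) < 0 :=
      sub_neg.mpr (Real.one_lt_exp_iff.mpr (mul_pos hpos h0))
    have hB : 1 - Real.exp β < 0 := sub_neg.mpr (Real.one_lt_exp_iff.mpr hpos)
    have hD := mul_neg_of_neg_of_pos hA hNB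
    refine ⟨div_pos_of_neg_of_neg (mul_neg_of_pos_of_neg hNA hB) hD, ?_⟩
    rw [div_lt_one_of_neg hD]
    linarith [mul_lt_mul_of_pos_left hkey hpos]
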